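/- Let φ be an even nonconstant polynomial of degree 2m with positive leading coefficient, ρ = e^{-φ}, and p large enough that A_p is strictly positive on ℝ. Let L̂_p(f) = −(f/A_p)' + (B_p + φ')·(f/A_p). Then for every j ∈ ℕ there exist polynomials Q_{k,j,p} for k = 0,…,j+1 such that for every smooth f and x ∈ ℝ: (L̂_p(f))^{(j)}(x) = Σ_{k=0}^{j+1} (Q_{k,j,p}(x) / A_p(x)^{2^{j+1−k}}) f^{(k)}(x), and these polynomials satisfy: (1) Q_{j+1,j,p} = −1; (2) deg Q_{k,j,p} ≤ 2^{j+1−k}(2m−2) + 1; (3) Q_{k,j,p} = a_p^{2^{j+1−k}(2m−1)−1} · Q̃_{k,j,p} where for each fixed j, k the coefficients of the polynomials Q̃_{k,j,p} are bounded uniformly in p. -/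

import Mathlib

open MeasureTheory Polynomial

/-- The operator L̂ (for a given A, B, φ'): L̂(f) = -(f/A)' + (B + φ')·(f/A). -/
noncomputable def lhat (Af Bf dphi : ℝ → ℝ) (f : ℝ → ℝ) : ℝ → ℝ := fun x =>
  -deriv (fun y => f y / Af y) x + (Bf x + dphi x) * (f x / Af x)

open Filter

lemma isBigO_eval_mul_exp_neg (φ : ℝ[X]) (hdeg : 2 ≤ φ.natDegree) (hlead : 0 < φ.leadingCoeff)
    (q : ℝ[X]) :
    (fun x : ℝ => q.eval x * Real.exp (-φ.eval x)) =O[atTop] fun x => Real.exp (-1 * x) := by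
  have hc : (φ - 2 * X).leadingCoeff = φ.leadingCoeff := by
    apply leadingCoeff_sub_of_degree_lt
    apply degree_lt_degree
    have : (2 * X : ℝ[X]).natDegree ≤ 1 := by compute_degree
    omega
  have hd : (φ - 2 * X).natDegree = φ.natDegree := by
    apply natDegree_sub_eq_left_of_natDegree_lt
    have : (2 * X : ℝ[X]).natDegree ≤ 1 := by compute_degree
    omega
  have h1 : Tendsto (fun x => (φ - 2 * X).eval x) atTop atTop := by
    apply tendsto_atTop_of_leadingCoeff_nonneg
    · rw [← natDegree_pos_iff_degree_pos]; omega
    · rw [hc]; exact hlead.le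
  have h2 : ∀ᶠ x : ℝ in atTop, |q.eval x / Real.exp x| ≤ 1 := by
    have := (q.tendsto_div_exp_atTop).abs
    rw [abs_zero] at this
    exact this.eventually_le_const one_pos
  refine Asymptotics.IsBigO.of_bound 1 ?_
  filter_upwards [h1.eventually_ge_atTop 0, h2] with x hx hx2
  rw [abs_div, Real.abs_exp, div_le_one (Real.exp_pos x)] at hx2
  simp only [eval_sub, eval_mul, eval_ofNat, eval_X] at hx
  rw [norm_mul, Real.norm_eq_abs, Real.norm_eq_abs, Real.norm_eq_abs, Real.abs_exp, Real.abs_exp,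
    one_mul]
  calc |q.eval x| * Real.exp (-φ.eval x) ≤ Real.exp x * Real.exp (-φ.eval x) := by gcongr
    _ = Real.exp (x - φ.eval x) := by rw [← Real.exp_add]; ring_nf
    _ ≤ _ := Real.exp_le_exp.2 (by linarith)

lemma integrable_eval_mul_exp_neg (φ : ℝ[X]) (hdeg : 2 ≤ φ.natDegree) (hlead : 0 < φ.leadingCoeff)
    (heven : ∀ x : ℝ, φ.eval (-x) = φ.eval x) (q : ℝ[X]) :
    Integrable fun x : ℝ => q.eval x * Real.exp (-φ.eval x) := by
  have key (q : ℝ[X]) :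
      IntegrableOn (fun x : ℝ => q.eval x * Real.exp (-φ.eval x)) (Set.Ioi 0) :=
    integrable_of_isBigO_exp_neg one_pos (by fun_prop)
      (isBigO_eval_mul_exp_neg φ hdeg hlead q)
  rw [← integrableOn_univ, ← Set.Iic_union_Ioi (a := (0 : ℝ))]
  refine IntegrableOn.union ?_ (key q)
  rw [integrableOn_Iic_iff_integrableOn_Iio]
  have h := (key (q.comp (-X)))
  rw [← neg_zero] at h
  simpa [heven] using h.comp_neg_Iio

lemma exists_lower_bound_of_even (q : ℝ[X]) (hdeg : 0 < q.natDegree) (hlead : 0 ≤ q.leadingCoeff)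
    (heven : ∀ x : ℝ, q.eval (-x) = q.eval x) : ∃ K : ℝ, ∀ x, -K ≤ q.eval x := by
  have h1 : Tendsto (fun x => q.eval x) atTop atTop :=
    q.tendsto_atTop_of_leadingCoeff_nonneg (natDegree_pos_iff_degree_pos.1 hdeg) hlead
  obtain ⟨R, hR⟩ := eventually_atTop.1 (h1.eventually_ge_atTop 0)
  obtain ⟨K, hK⟩ := isCompact_Icc.exists_bound_of_continuousOn
    (s := Set.Icc 0 R) (f := fun x => q.eval x) (by fun_prop)
  have h0 (x : ℝ) (hx : 0 ≤ x) : -max K 0 ≤ q.eval x := by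
    rcases le_total R x with h | h
    · exact (neg_nonpos.2 (le_max_right _ _)).trans (hR x h)
    · exact (neg_le_neg (le_max_left _ _)).trans (abs_le.1 (hK x ⟨hx, h⟩)).1
  refine ⟨max K 0, fun x => ?_⟩
  rcases le_total 0 x with h | h
  · exact h0 x h
  · rw [← heven]; exact h0 _ (neg_nonneg.2 h)

noncomputable def weightFunctional (ρ : ℝ → ℝ)
    (h : ∀ q : ℝ[X], Integrable fun x : ℝ => q.eval x * ρ x) : ℝ[X] →ₗ[ℝ] ℝ where
  toFun q := ∫ x : ℝ, q.eval x * ρ x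
  map_add' q r := by simp only [eval_add, add_mul]; exact integral_add (h q) (h r)
  map_smul' c q := by
    simp only [eval_smul, smul_eq_mul, mul_assoc, RingHom.id_apply]
    exact integral_const_mul _ _

lemma coeff_comp_neg_X (q : ℝ[X]) (k : ℕ) : (q.comp (-X)).coeff k = q.coeff k * (-1) ^ k := by
  have : (-X : ℝ[X]) = C (-1) * X := by simp
  rw [this, comp_C_mul_X_coeff]

section functional

variable {L : ℝ[X] →ₗ[ℝ] ℝ} {P : ℕ → ℝ[X]} (hPdeg : ∀ n, (P n).natDegree = n)
  (hPlead : ∀ n, 0 < (P n).leadingCoeff)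
  (hL : ∀ i j, L (P i * P j) = if i = j then (1 : ℝ) else 0)

include hPdeg in
lemma coeff_self_eq (n : ℕ) : (P n).coeff n = (P n).leadingCoeff := by
  rw [leadingCoeff, hPdeg]

include hPdeg hPlead in
lemma degree_sub_leading_lt {q : ℝ[X]} {n : ℕ} (hq : q.degree < (n + 1 : ℕ)) :
    (q - (q.coeff n / (P n).coeff n) • P n).degree < n := by
  rw [degree_lt_iff_coeff_zero] at hq ⊢
  intro k hk
  rcases hk.eq_or_lt with rfl | hk
  · have := (hPlead n).ne'
    rw [← coeff_self_eq hPdeg] at this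
    simp [this]
  · simp [hq k hk, coeff_eq_zero_of_natDegree_lt ((hPdeg n).trans_lt hk)]

include hPdeg hPlead hL in
lemma orthogonal_of_degree_lt {n N : ℕ} (hN : N ≤ n) {q : ℝ[X]} (hq : q.degree < N) :
    L (q * P n) = 0 := by
  induction N generalizing q with
  | zero =>
    have : q = 0 := by ext k; simpa using (degree_lt_iff_coeff_zero q 0).1 hq k (Nat.zero_le k)
    simp [this]
  | succ N ih =>
    have h := ih (by omega) (degree_sub_leading_lt hPdeg hPlead hq)
    rwa [sub_mul, map_sub, smul_mul_assoc, map_smul, hL, if_neg (by omega), smul_zero,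
      sub_zero] at h

include hPdeg hPlead hL in
lemma functional_mul_eq_coeff_div {n : ℕ} {q : ℝ[X]} (hq : q.natDegree ≤ n) :
    L (q * P n) = q.coeff n / (P n).coeff n := by
  have hq' : q.degree < (n + 1 : ℕ) := by
    exact (degree_le_of_natDegree_le hq).trans_lt (WithBot.coe_lt_coe.2 (Nat.lt_succ_self n))
  have h := orthogonal_of_degree_lt hPdeg hPlead hL le_rfl
    (degree_sub_leading_lt hPdeg hPlead hq')
  rw [sub_mul, map_sub, smul_mul_assoc, map_smul, hL, if_pos rfl, smul_eq_mul, mul_one,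
      sub_eq_zero] at h
  exact h

include hPdeg hPlead hL in
lemma functional_mul_derivative_self (n : ℕ) :
    L (derivative (X * P n ^ 2)) = 2 * n + 1 := by
  have hc := (hPlead n).ne'
  rw [← coeff_self_eq hPdeg] at hc
  have h1 : L (X * derivative (P n) * P n) = n := by
    rw [functional_mul_eq_coeff_div hPdeg hPlead hL]
    · rcases n with _ | n
      · simp
      · rw [coeff_X_mul, coeff_derivative]; push_cast; field_simp
    · rcases n with _ | n
      · simp [derivative_of_natDegree_zero (hPdeg 0)]
      · refine natDegree_mul_le.trans ?_
        have := natDegree_derivative_le (P (n + 1))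
        rw [hPdeg] at this
        rw [natDegree_X]
        omega
  have h2 : derivative (X * P n ^ 2) = P n * P n + (2 : ℝ) • (X * derivative (P n) * P n) := by
    rw [derivative_mul, derivative_X, derivative_pow, smul_eq_C_mul]
    simp
    ring
  rw [h2, map_add, map_smul, hL, h1, if_pos rfl, smul_eq_mul]; ring

include hPdeg hPlead hL in
lemma functional_recursion_mul (n : ℕ) :
    L (X * P n * P (n + 1)) * L (derivative (P (n + 1) * P n)) = n + 1 := by
  have hc := (hPlead n).ne'
  rw [← coeff_self_eq hPdeg] at hc
  have hc' := (hPlead (n + 1)).ne'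
  rw [← coeff_self_eq hPdeg] at hc'
  have h1 : L (X * P n * P (n + 1)) = (P n).coeff n / (P (n + 1)).coeff (n + 1) := by
    rw [functional_mul_eq_coeff_div hPdeg hPlead hL, coeff_X_mul]
    refine natDegree_mul_le.trans ?_
    rw [natDegree_X, hPdeg, add_comm]
  have h2 : L (derivative (P (n + 1)) * P n) = (P (n + 1)).coeff (n + 1) * (n + 1) / (P n).coeff n := by
    rw [functional_mul_eq_coeff_div hPdeg hPlead hL, coeff_derivative]
    refine (natDegree_derivative_le _).trans ?_
    rw [hPdeg, Nat.add_sub_cancel]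
  have h3 : L (derivative (P n) * P (n + 1)) = 0 := by
    refine orthogonal_of_degree_lt hPdeg hPlead hL le_rfl ?_
    refine (degree_le_of_natDegree_le ((natDegree_derivative_le _).trans ?_)).trans_lt
      (WithBot.coe_lt_coe.2 (Nat.lt_succ_self n))
    rw [hPdeg]; omega
  rw [derivative_mul, map_add, mul_comm (P (n + 1)), h1, h2, h3]
  field_simp
  ring

include hPdeg hPlead hL in
lemma comp_neg_X_eq (hneg : ∀ q : ℝ[X], L (q.comp (-X)) = L q) (n : ℕ) :
    (P n).comp (-X) = (-1 : ℝ) ^ n • P n := by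
  by_contra hne
  set r := (P n).comp (-X) - (-1 : ℝ) ^ n • P n with hr
  have hr0 : r ≠ 0 := sub_ne_zero.2 hne
  have hdeg : r.degree < n := by
    rw [degree_lt_iff_coeff_zero]
    intro k hk
    rcases hk.eq_or_lt with rfl | hk
    · simp [hr, coeff_comp_neg_X, mul_comm]
    · simp [hr, coeff_comp_neg_X, coeff_eq_zero_of_natDegree_lt ((hPdeg n).trans_lt hk)]
  have hlt : r.natDegree < n := (natDegree_lt_iff_degree_lt hr0).2 hdeg
  have h1 : L (r * P r.natDegree) = r.leadingCoeff / (P r.natDegree).leadingCoeff := by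
    rw [functional_mul_eq_coeff_div hPdeg hPlead hL le_rfl, coeff_self_eq hPdeg]; rfl
  have h2 : L (r * P r.natDegree) = 0 := by
    nth_rewrite 1 [hr]
    rw [sub_mul, map_sub, smul_mul_assoc, map_smul, hL, if_neg hlt.ne', smul_zero, sub_zero,
      ← hneg, mul_comp, comp_assoc, neg_comp, X_comp, neg_neg, comp_X, mul_comm]
    refine orthogonal_of_degree_lt hPdeg hPlead hL le_rfl ?_
    refine (degree_le_of_natDegree_le (n := r.natDegree) (natDegree_comp_le.trans ?_)).trans_lt
      (Nat.cast_lt.2 hlt)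
    rw [natDegree_neg, natDegree_X, mul_one, hPdeg]
  rw [h1] at h2
  exact (div_ne_zero (leadingCoeff_ne_zero.2 hr0) (hPlead _).ne') h2

include hPdeg hPlead hL in
lemma functional_even_pow_mul_eq_zero (hneg : ∀ q : ℝ[X], L (q.comp (-X)) = L q) (n : ℕ) {l : ℕ}
    (hl : Even l) : L (X ^ l * (P (n + 1) * P n)) = 0 := by
  have h := hneg (X ^ l * (P (n + 1) * P n))
  rw [mul_comp, mul_comp, comp_neg_X_eq hPdeg hPlead hL hneg, comp_neg_X_eq hPdeg hPlead hL hneg,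
    X_pow_comp, hl.neg_pow, smul_mul_smul_comm, mul_smul_comm, map_smul, ← pow_add,
    Odd.neg_one_pow ⟨n, by ring⟩, smul_eq_mul] at h
  linarith

end functional

section moments

variable {L : ℝ[X] →ₗ[ℝ] ℝ}

lemma abs_functional_pow_mul_le (hpos : ∀ q : ℝ[X], (∀ x, 0 ≤ q.eval x) → 0 ≤ L q) {m : ℕ}
    {V W : ℝ[X]} (hVW : ∀ x, |V.eval x| ≤ W.eval x) {s K₀ K : ℝ} (hs : 0 < s) (h₀ : L W ≤ K₀)
    (hK : L (X ^ (2 * m) * W) ≤ K * s ^ (2 * m)) {l : ℕ} (hl : l ≤ 2 * m) :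
    |L (X ^ l * V)| ≤ (K₀ + K) * s ^ l := by
  have hpt (y : ℝ) : |y| ^ l ≤ s ^ l + s ^ l / s ^ (2 * m) * y ^ (2 * m) := by
    have h : (|y| / s) ^ l ≤ 1 + (|y| / s) ^ (2 * m) := by
      rcases le_total (|y| / s) 1 with h | h
      · exact (pow_le_one₀ (by positivity) h).trans (le_add_of_nonneg_right (by positivity))
      · exact (pow_le_pow_right₀ h hl).trans (le_add_of_nonneg_left zero_le_one)
    rw [div_pow, div_pow, (even_two_mul m).pow_abs, div_le_iff₀ (by positivity)] at h
    refine h.trans_eq ?_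
    ring
  have hpt' (y : ℝ) :
      |y ^ l * V.eval y| ≤ (s ^ l + s ^ l / s ^ (2 * m) * y ^ (2 * m)) * W.eval y := by
    rw [abs_mul, abs_pow]
    exact mul_le_mul (hpt y) (hVW y) (abs_nonneg _) ((by positivity : (0:ℝ) ≤ |y| ^ l).trans (hpt y))
  have hbound : s ^ l * L W + s ^ l / s ^ (2 * m) * L (X ^ (2 * m) * W) ≤ (K₀ + K) * s ^ l :=
    calc _ ≤ s ^ l * K₀ + s ^ l / s ^ (2 * m) * (K * s ^ (2 * m)) := by gcongr
      _ = _ := by field_simp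
  have h1 := hpos (s ^ l • W + (s ^ l / s ^ (2 * m)) • (X ^ (2 * m) * W) - X ^ l * V) fun y => by
    have := (abs_le.1 (hpt' y)).2
    simp only [eval_sub, eval_add, eval_smul, eval_mul, eval_pow, eval_X, smul_eq_mul]
    linarith
  have h2 := hpos (s ^ l • W + (s ^ l / s ^ (2 * m)) • (X ^ (2 * m) * W) + X ^ l * V) fun y => by
    have := (abs_le.1 (hpt' y)).1
    simp only [eval_add, eval_smul, eval_mul, eval_pow, eval_X, smul_eq_mul]
    linarith
  simp only [map_sub, map_add, map_smul, smul_eq_mul] at h1 h2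
  exact abs_le.2 ⟨by linarith, by linarith⟩

variable {P : ℕ → ℝ[X]} (hPdeg : ∀ n, (P n).natDegree = n)
  (hPlead : ∀ n, 0 < (P n).leadingCoeff)
  (hL : ∀ i j, L (P i * P j) = if i = j then (1 : ℝ) else 0)
  (hpos : ∀ q : ℝ[X], (∀ x, 0 ≤ q.eval x) → 0 ≤ L q)
  {ψ : ℝ[X]} (hibp : ∀ q : ℝ[X], L (derivative q) = L (ψ * q))
  {m : ℕ} {c K : ℝ} (hc : 0 < c)
  (hψ : ∀ x : ℝ, c * x ^ (2 * m) - K ≤ x * ψ.eval x)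

include hPdeg hPlead hL hpos hibp hc hψ in
lemma exists_top_moment_le : ∃ C : ℝ, 0 ≤ C ∧ ∀ n : ℕ, L (X ^ (2 * m) * P n ^ 2) ≤ C * (n + 1) := by
  refine ⟨(2 + |K|) / c, by positivity, fun n => ?_⟩
  have h1 := hpos (ψ * (X * P n ^ 2) + K • (P n * P n) - c • (X ^ (2 * m) * P n ^ 2)) fun x => by
    simp only [eval_sub, eval_add, eval_smul, eval_mul, eval_pow, eval_X, smul_eq_mul]
    nlinarith [mul_nonneg (sub_nonneg.2 (hψ x)) (sq_nonneg ((P n).eval x))]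
  rw [map_sub, map_add, ← hibp, functional_mul_derivative_self hPdeg hPlead hL, map_smul, map_smul,
    hL, if_pos rfl, smul_eq_mul, smul_eq_mul] at h1
  rw [div_mul_eq_mul_div, le_div_iff₀ hc]
  have : 0 ≤ |K| * n := by positivity
  linarith [le_abs_self K]

include hPdeg hPlead hL hpos hibp hc hψ in
lemma exists_moment_bounds (hm : 1 ≤ m) (hψdeg : ψ.natDegree ≤ 2 * m - 1) :
    ∃ κ M : ℝ, 0 < κ ∧ 0 ≤ M ∧ ∀ n : ℕ, κ ≤ |L (X * P n * P (n + 1))| ∧ ∀ l ≤ 2 * m,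
      |L (X ^ l * P (n + 1) ^ 2)| ≤ M * |L (X * P n * P (n + 1))| ^ l ∧
      |L (X ^ l * (P (n + 1) * P n))| ≤ M * |L (X * P n * P (n + 1))| ^ l := by
  obtain ⟨C, hC0, hC⟩ := exists_top_moment_le hPdeg hPlead hL hpos hibp hc hψ
  set T : ℝ := ∑ k ∈ Finset.range (2 * m), |ψ.coeff k| with hT
  set D : ℝ := 2 * (T * (2 + 2 * C)) + 1 with hD
  have hT0 : 0 ≤ T := by positivity
  have hD0 : 1 ≤ D := by rw [hD]; linarith [(by positivity : 0 ≤ T * (2 + 2 * C))]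
  refine ⟨1 / D, (2 + 2 * C) * D ^ (2 * m), by positivity, by positivity, fun n => ?_⟩
  set a := L (X * P n * P (n + 1)) with ha
  set s : ℝ := ((n : ℝ) + 2) ^ (1 / ((2 * m : ℕ) : ℝ)) with hs
  have hs1 : 1 ≤ s := Real.one_le_rpow (by linarith [(Nat.cast_nonneg n : (0 : ℝ) ≤ n)])
    (by positivity)
  have hs2 : s ^ (2 * m) = n + 2 := by
    rw [hs, one_div, Real.rpow_inv_natCast_pow (by positivity) (by omega)]
  have hW0 : L (P (n + 1) ^ 2 + P n ^ 2) ≤ 2 := by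
    rw [map_add, sq, sq, hL, hL, if_pos rfl, if_pos rfl]; norm_num
  have hWm : L (X ^ (2 * m) * (P (n + 1) ^ 2 + P n ^ 2)) ≤ 2 * C * s ^ (2 * m) := by
    rw [mul_add, map_add, hs2]
    have h1 := hC (n + 1)
    push_cast at h1
    linarith [hC n]
  have hsq (l : ℕ) (hl : l ≤ 2 * m) : |L (X ^ l * P (n + 1) ^ 2)| ≤ (2 + 2 * C) * s ^ l := by
    refine abs_functional_pow_mul_le hpos (fun x => ?_) (by linarith) hW0 hWm hl
    simp only [eval_add, eval_pow]
    rw [abs_of_nonneg (sq_nonneg _)]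
    exact le_add_of_nonneg_right (sq_nonneg _)
  have hmix (l : ℕ) (hl : l ≤ 2 * m) :
      |L (X ^ l * (P (n + 1) * P n))| ≤ (2 + 2 * C) * s ^ l := by
    refine abs_functional_pow_mul_le hpos (fun x => ?_) (by linarith) hW0 hWm hl
    simp only [eval_add, eval_pow, eval_mul]
    rw [abs_le]
    constructor <;> nlinarith [sq_nonneg ((P (n + 1)).eval x + (P n).eval x),
      sq_nonneg ((P (n + 1)).eval x - (P n).eval x), sq_nonneg ((P (n + 1)).eval x),
      sq_nonneg ((P n).eval x)]
  have hψbound : |L (ψ * (P (n + 1) * P n))| ≤ T * (2 + 2 * C) * s ^ (2 * m - 1) := by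
    rw [ψ.as_sum_range' (2 * m) (by omega), Finset.sum_mul, map_sum, hT, Finset.sum_mul,
      Finset.sum_mul]
    refine (Finset.abs_sum_le_sum_abs _ _).trans (Finset.sum_le_sum fun k hk => ?_)
    rw [Finset.mem_range] at hk
    rw [← smul_X_eq_monomial, smul_mul_assoc, map_smul, smul_eq_mul, abs_mul, mul_assoc]
    refine mul_le_mul_of_nonneg_left ((hmix k hk.le).trans ?_) (abs_nonneg _)
    exact mul_le_mul_of_nonneg_left (pow_le_pow_right₀ hs1 (by omega)) (by linarith)
  have hfreud : a * L (ψ * (P (n + 1) * P n)) = n + 1 := by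
    rw [← hibp]
    exact functional_recursion_mul hPdeg hPlead hL n
  have hsa : s ≤ D * |a| := by
    have h1 : s * s ^ (2 * m - 1) = n + 2 := by
      rw [← pow_succ', ← hs2, Nat.sub_add_cancel (by omega)]
    have h2 : (n : ℝ) + 1 ≤ |a| * (T * (2 + 2 * C) * s ^ (2 * m - 1)) := by
      rw [← hfreud]
      refine (le_abs_self _).trans ?_
      rw [abs_mul]
      gcongr
    have h3 : 0 < s ^ (2 * m - 1) := by positivity
    refine le_of_mul_le_mul_right ?_ h3
    rw [h1, hD]
    have h4 : 0 ≤ |a| * s ^ (2 * m - 1) := by positivity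
    have h5 : (0 : ℝ) ≤ n := n.cast_nonneg
    linarith
  refine ⟨by rw [div_le_iff₀' (by positivity)]; exact hs1.trans hsa, fun l hl => ?_⟩
  have hsl : (2 + 2 * C) * s ^ l ≤ (2 + 2 * C) * D ^ (2 * m) * |a| ^ l := by
    rw [mul_assoc]
    gcongr
    calc s ^ l ≤ (D * |a|) ^ l := by gcongr
      _ = D ^ l * |a| ^ l := mul_pow _ _ _
      _ ≤ _ := by gcongr
  exact ⟨(hsq l hl).trans hsl, (hmix l hl).trans hsl⟩

end moments

section controlled

/-- The degrees of `F p` are at most `N` and the coefficients of `F p` are `O(|a p| ^ r)`,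
uniformly in `p`. -/
def IsControlled (a : ℕ → ℝ) (r N : ℕ) (F : ℕ → ℝ[X]) : Prop :=
  (∀ p, (F p).natDegree ≤ N) ∧ ∃ C : ℝ, 0 ≤ C ∧ ∀ p i, |(F p).coeff i| ≤ C * |a p| ^ r

variable {a : ℕ → ℝ} {r r' N N' : ℕ} {F G : ℕ → ℝ[X]}

lemma IsControlled.mono (h : IsControlled a r N F) {κ : ℝ} (hκ : 0 < κ) (ha : ∀ p, κ ≤ |a p|)
    (hr : r ≤ r') (hN : N ≤ N') : IsControlled a r' N' F := by
  obtain ⟨hd, C, hC, h⟩ := h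
  refine ⟨fun p => (hd p).trans hN, C / κ ^ (r' - r), by positivity, fun p i => ?_⟩
  refine (h p i).trans ?_
  rw [div_mul_eq_mul_div, le_div_iff₀ (by positivity), mul_assoc]
  gcongr
  rw [← Nat.add_sub_cancel' hr, pow_add, Nat.add_sub_cancel_left]
  gcongr
  exact ha p

lemma IsControlled.add (hF : IsControlled a r N F) (hG : IsControlled a r N G) :
    IsControlled a r N fun p => F p + G p := by
  obtain ⟨hd, C, hC, h⟩ := hF
  obtain ⟨hd', C', hC', h'⟩ := hG
  refine ⟨fun p => natDegree_add_le_of_degree_le (hd p) (hd' p), C + C', by positivity,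
    fun p i => ?_⟩
  rw [coeff_add, add_mul]
  exact (abs_add_le _ _).trans (add_le_add (h p i) (h' p i))

lemma IsControlled.smul (hF : IsControlled a r N F) (t : ℝ) :
    IsControlled a r N fun p => t • F p := by
  obtain ⟨hd, C, hC, h⟩ := hF
  refine ⟨fun p => (natDegree_smul_le _ _).trans (hd p), |t| * C, by positivity, fun p i => ?_⟩
  rw [coeff_smul, smul_eq_mul, abs_mul, mul_assoc]
  gcongr
  exact h p i

lemma IsControlled.mul (hF : IsControlled a r N F) (hG : IsControlled a r' N' G) :
    IsControlled a (r + r') (N + N') fun p => F p * G p := by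
  obtain ⟨hd, C, hC, h⟩ := hF
  obtain ⟨hd', C', hC', h'⟩ := hG
  refine ⟨fun p => natDegree_mul_le_of_le (hd p) (hd' p), (N + N' + 1) * (C * C'), by positivity,
    fun p i => ?_⟩
  rcases lt_or_ge (N + N') i with hi | hi
  · rw [coeff_eq_zero_of_natDegree_lt ((natDegree_mul_le_of_le (hd p) (hd' p)).trans_lt hi),
      abs_zero]
    positivity
  rw [coeff_mul]
  calc |∑ x ∈ Finset.HasAntidiagonal.antidiagonal i, (F p).coeff x.1 * (G p).coeff x.2|
      ≤ ∑ x ∈ Finset.HasAntidiagonal.antidiagonal i, (C * |a p| ^ r) * (C' * |a p| ^ r') := by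
        refine (Finset.abs_sum_le_sum_abs _ _).trans (Finset.sum_le_sum fun x _ => ?_)
        rw [abs_mul]
        exact mul_le_mul (h _ _) (h' _ _) (abs_nonneg _) (by positivity)
    _ = (i + 1) * (C * C') * |a p| ^ (r + r') := by
        rw [Finset.sum_const, Finset.Nat.card_antidiagonal, nsmul_eq_mul]; push_cast; ring
    _ ≤ _ := by gcongr; exact_mod_cast hi

lemma isControlled_const (q : ℝ[X]) (hq : q.natDegree ≤ N) : IsControlled a 0 N fun _ => q := by
  refine ⟨fun _ => hq, ∑ i ∈ Finset.range (N + 1), |q.coeff i|, by positivity, fun p i => ?_⟩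
  rw [pow_zero, mul_one]
  rcases lt_or_ge N i with hi | hi
  · rw [coeff_eq_zero_of_natDegree_lt (hq.trans_lt hi), abs_zero]; positivity
  · exact Finset.single_le_sum (f := fun i => |q.coeff i|) (fun _ _ => abs_nonneg _)
      (Finset.mem_range.2 (Nat.lt_succ_of_le hi))

lemma IsControlled.pow (hF : IsControlled a r N F) (n : ℕ) :
    IsControlled a (n * r) (n * N) fun p => F p ^ n := by
  induction n with
  | zero => simpa using isControlled_const (a := a) (N := 0) 1 (by simp)
  | succ n ih =>
    simp only [pow_succ, Nat.succ_mul]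
    exact ih.mul hF

lemma IsControlled.derivative (hF : IsControlled a r N F) :
    IsControlled a r N fun p => derivative (F p) := by
  obtain ⟨hd, C, hC, h⟩ := hF
  have hd' (p : ℕ) : (Polynomial.derivative (F p)).natDegree ≤ N :=
    (natDegree_derivative_le _).trans ((Nat.sub_le _ _).trans (hd p))
  refine ⟨hd', C * (N + 1), by positivity, fun p i => ?_⟩
  rcases lt_or_ge N i with hi | hi
  · rw [coeff_eq_zero_of_natDegree_lt ((hd' p).trans_lt hi), abs_zero]; positivity
  rw [coeff_derivative, abs_mul, mul_right_comm, abs_of_nonneg (by positivity : (0 : ℝ) ≤ i + 1)]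
  gcongr
  exact h _ _

lemma isControlled_of_succ (ha : a 0 ≠ 0) (hd : ∀ p, (F p).natDegree ≤ N)
    (h : ∃ C : ℝ, 0 ≤ C ∧ ∀ p i, |(F (p + 1)).coeff i| ≤ C * |a (p + 1)| ^ r) :
    IsControlled a r N F := by
  obtain ⟨C, hC, h⟩ := h
  obtain ⟨-, C₀, hC₀, h₀⟩ := isControlled_const (a := a) (F 0) (hd 0)
  refine ⟨hd, C + C₀ / |a 0| ^ r, by positivity, fun p i => ?_⟩
  rw [add_mul]
  rcases p with _ | p
  · refine le_trans ?_ (le_add_of_nonneg_left (by positivity))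
    rw [div_mul_cancel₀ _ (by positivity)]
    simpa using h₀ 0 i
  · exact (h p i).trans (le_add_of_nonneg_right (by positivity))

end controlled

section dividedDifference

/-- The polynomial `x ↦ L_y ((q(x) - q(y)) / (x - y) * W(y))`. -/
noncomputable def dividedDifferenceTransform (L : ℝ[X] →ₗ[ℝ] ℝ) (q W : ℝ[X]) : ℝ[X] :=
  ∑ k ∈ Finset.range (q.natDegree + 1), ∑ i ∈ Finset.range k,
    (q.coeff k * L (X ^ (k - 1 - i) * W)) • X ^ i

/-- The polynomial `y ↦ (q(x) - q(y)) / (x - y)`. -/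
noncomputable def dividedDifference (q : ℝ[X]) (x : ℝ) : ℝ[X] :=
  ∑ k ∈ Finset.range (q.natDegree + 1), ∑ i ∈ Finset.range k,
    (q.coeff k * x ^ i) • X ^ (k - 1 - i)

lemma eval_dividedDifference_mul (q : ℝ[X]) (x y : ℝ) :
    (dividedDifference q x).eval y * (x - y) = q.eval x - q.eval y := by
  rw [dividedDifference, eval_finsetSum, Finset.sum_mul, eval_eq_sum_range, eval_eq_sum_range,
    ← Finset.sum_sub_distrib]
  refine Finset.sum_congr rfl fun k _ => ?_
  rw [← mul_sub, ← geom_sum₂_mul, ← mul_assoc, Finset.mul_sum, eval_finsetSum]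
  simp [mul_assoc]

lemma eval_dividedDifferenceTransform (L : ℝ[X] →ₗ[ℝ] ℝ) (q W : ℝ[X]) (x : ℝ) :
    (dividedDifferenceTransform L q W).eval x = L (dividedDifference q x * W) := by
  simp only [dividedDifferenceTransform, dividedDifference, eval_finsetSum, Finset.sum_mul, map_sum,
    smul_mul_assoc, map_smul, eval_smul, smul_eq_mul, eval_pow, eval_X]
  refine Finset.sum_congr rfl fun k _ => Finset.sum_congr rfl fun i _ => ?_
  ring

lemma natDegree_dividedDifferenceTransform_le (L : ℝ[X] →ₗ[ℝ] ℝ) (q W : ℝ[X]) :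
    (dividedDifferenceTransform L q W).natDegree ≤ q.natDegree - 1 := by
  refine natDegree_sum_le_of_forall_le _ _ fun k hk =>
    natDegree_sum_le_of_forall_le _ _ fun i hi => ?_
  rw [Finset.mem_range] at hk hi
  refine (natDegree_smul_le _ _).trans ?_
  rw [natDegree_X_pow]
  omega

lemma abs_coeff_dividedDifferenceTransform_le (L : ℝ[X] →ₗ[ℝ] ℝ) (q W : ℝ[X]) {K : ℝ}
    (hK : ∀ l ≤ q.natDegree - 1, |L (X ^ l * W)| ≤ K) (i : ℕ) :
    |(dividedDifferenceTransform L q W).coeff i|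
      ≤ (∑ k ∈ Finset.range (q.natDegree + 1), ∑ _i ∈ Finset.range k, |q.coeff k|) * K := by
  have hK0 : 0 ≤ K := (abs_nonneg _).trans (hK 0 (Nat.zero_le _))
  simp only [dividedDifferenceTransform, finsetSum_coeff, Finset.sum_mul]
  refine (Finset.abs_sum_le_sum_abs _ _).trans (Finset.sum_le_sum fun k hk =>
    (Finset.abs_sum_le_sum_abs _ _).trans (Finset.sum_le_sum fun i' hi => ?_))
  rw [Finset.mem_range] at hk hi
  rw [coeff_smul, coeff_X_pow, smul_eq_mul, abs_mul, abs_mul]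
  have h := hK (k - 1 - i') (by omega)
  split_ifs
  · rw [abs_one, mul_one]; gcongr
  · rw [abs_zero, mul_zero]; positivity

end dividedDifference

section operator

/-- The numerators of the coefficients of the `j`-th derivative of `L̂ f` for `A = α` and
`B + φ' = β`. -/
noncomputable def lhatNumerator (α β : ℝ[X]) : ℕ → ℕ → ℝ[X]
  | 0, 0 => derivative α + β * α
  | 0, 1 => -1
  | 0, _ + 2 => 0
  | j + 1, 0 => (derivative (lhatNumerator α β j 0) * α
      + (-(2 : ℝ) ^ (j + 1)) • (lhatNumerator α β j 0 * derivative α)) * α ^ (2 ^ (j + 1) - 1)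
  | j + 1, k + 1 => lhatNumerator α β j k + (derivative (lhatNumerator α β j (k + 1)) * α
      + (-(2 : ℝ) ^ (j + 1 - (k + 1))) • (lhatNumerator α β j (k + 1) * derivative α))
        * α ^ (2 ^ (j + 1 - (k + 1)) - 1)

lemma lhatNumerator_eq_zero (α β : ℝ[X]) {j k : ℕ} (h : j + 1 < k) :
    lhatNumerator α β j k = 0 := by
  induction j generalizing k with
  | zero =>
    obtain ⟨k, rfl⟩ := Nat.exists_eq_add_of_lt h
    rw [show 0 + 1 + k + 1 = k + 2 by ring, lhatNumerator]
  | succ j ih =>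
    rcases k with _ | k
    · omega
    · rw [lhatNumerator, ih (by omega), ih (by omega)]; simp

lemma lhatNumerator_top (α β : ℝ[X]) (j : ℕ) : lhatNumerator α β j (j + 1) = -1 := by
  induction j with
  | zero => rw [lhatNumerator]
  | succ j ih => rw [lhatNumerator, ih, lhatNumerator_eq_zero α β (by omega)]; simp

lemma isControlled_lhatNumerator {a : ℕ → ℝ} {κ : ℝ} (hκ : 0 < κ) (ha : ∀ p, κ ≤ |a p|)
    {α β : ℕ → ℝ[X]} {d : ℕ} (hα : IsControlled a (d + 1) d α) (hβ : IsControlled a d (d + 1) β)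
    {j k : ℕ} (hk : k ≤ j + 1) :
    IsControlled a (2 ^ (j + 1 - k) * (d + 1) - 1) (2 ^ (j + 1 - k) * d + 1)
      fun p => lhatNumerator (α p) (β p) j k := by
  have step {j k : ℕ} (hk : k ≤ j + 1)
      (h : IsControlled a (2 ^ (j + 1 - k) * (d + 1) - 1) (2 ^ (j + 1 - k) * d + 1)
        fun p => lhatNumerator (α p) (β p) j k) :
      IsControlled a (2 ^ (j + 1 + 1 - k) * (d + 1) - 1) (2 ^ (j + 1 + 1 - k) * d + 1) fun p =>
        (derivative (lhatNumerator (α p) (β p) j k) * α p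
        + (-(2 : ℝ) ^ (j + 1 - k)) • (lhatNumerator (α p) (β p) j k * derivative (α p)))
          * α p ^ (2 ^ (j + 1 - k) - 1) := by
    refine (((h.derivative.mul hα).add ((h.mul hα.derivative).smul _)).mul
      (hα.pow _)).mono hκ ha ?_ ?_ <;>
    · rw [show j + 1 + 1 - k = j + 1 - k + 1 by omega, pow_succ]
      obtain ⟨e, he⟩ := Nat.exists_eq_add_of_lt (Nat.two_pow_pos (j + 1 - k))
      rw [he]
      simp only [zero_add, Nat.add_sub_cancel]
      have := Nat.zero_le (e * d)
      ring_nf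
      omega
  induction j generalizing k with
  | zero =>
    rcases (by omega : k = 0 ∨ k = 1) with rfl | rfl
    · simp only [lhatNumerator]
      refine (hα.derivative.mono hκ ha ?_ ?_).add ((hβ.mul hα).mono hκ ha ?_ ?_) <;> omega
    · simp only [lhatNumerator]
      exact (isControlled_const (N := 0) (-1) (by simp)).mono hκ ha (by omega) (by omega)
  | succ j ih =>
    rcases k with _ | k
    · simp only [lhatNumerator]
      exact step (Nat.zero_le _) (ih (Nat.zero_le _))
    · simp only [lhatNumerator]
      have h1 := ih (k := k) (by omega)
      rw [show j + 1 - k = j + 1 + 1 - (k + 1) by omega] at h1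
      rcases (by omega : k + 1 ≤ j + 1 ∨ k + 1 = j + 2) with h | h
      · exact h1.add (step h (ih h))
      · have h0 (p : ℕ) : lhatNumerator (α p) (β p) j (k + 1) = 0 :=
          lhatNumerator_eq_zero _ _ (by omega)
        simpa [h0] using h1

lemma lhat_eq {α β : ℝ[X]} {Af Bf dphi : ℝ → ℝ} (hA : ∀ x, Af x = α.eval x)
    (hβ : ∀ x, Bf x + dphi x = β.eval x) (hα : ∀ x, α.eval x ≠ 0) {f : ℝ → ℝ}
    (hf : Differentiable ℝ f) (x : ℝ) :
    lhat Af Bf dphi f x = (derivative α + β * α).eval x / α.eval x ^ 2 * f x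
      + (-1) / α.eval x * deriv f x := by
  obtain rfl : Af = fun x => α.eval x := funext hA
  have h : HasDerivAt (fun y => f y / α.eval y) _ x :=
    (hf x).hasDerivAt.div (α.hasDerivAt x) (hα x)
  have hx := hα x
  rw [lhat, h.deriv, hβ, eval_add, eval_mul]
  field_simp
  ring

lemma iteratedDeriv_lhat {α β : ℝ[X]} {Af Bf dphi : ℝ → ℝ} (hA : ∀ x, Af x = α.eval x)
    (hβ : ∀ x, Bf x + dphi x = β.eval x) (hα : ∀ x, α.eval x ≠ 0) {f : ℝ → ℝ}
    (hf : ContDiff ℝ (⊤ : ℕ∞) f) (j : ℕ) :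
    iteratedDeriv j (lhat Af Bf dphi f) = fun x => ∑ k ∈ Finset.range (j + 2),
      (lhatNumerator α β j k).eval x / α.eval x ^ (2 ^ (j + 1 - k)) * iteratedDeriv k f x := by
  induction j with
  | zero =>
    funext x
    rw [iteratedDeriv_zero, lhat_eq hA hβ hα (hf.differentiable (by simp)),
      Finset.sum_range_succ, Finset.sum_range_one]
    simp [lhatNumerator]
  | succ j ih =>
    funext x
    have hx := hα x
    have hterm (k : ℕ) : HasDerivAt (fun x => (lhatNumerator α β j k).eval x
          / α.eval x ^ (2 ^ (j + 1 - k)) * iteratedDeriv k f x)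
        (((derivative (lhatNumerator α β j k) * α
          + (-(2 : ℝ) ^ (j + 1 - k)) • (lhatNumerator α β j k * derivative α))
            * α ^ (2 ^ (j + 1 - k) - 1)).eval x / α.eval x ^ (2 ^ (j + 1 - k) * 2)
            * iteratedDeriv k f x
          + (lhatNumerator α β j k).eval x / α.eval x ^ (2 ^ (j + 1 - k))
            * iteratedDeriv (k + 1) f x) x := by
      have h1 := ((lhatNumerator α β j k).hasDerivAt x).div
        ((α.hasDerivAt x).pow (2 ^ (j + 1 - k))) (pow_ne_zero _ hx)
      have h2 : HasDerivAt (iteratedDeriv k f) (iteratedDeriv (k + 1) f x) x := by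
        rw [iteratedDeriv_succ]
        exact (hf.differentiable_iteratedDeriv k (by exact_mod_cast WithTop.coe_lt_top k)
          x).hasDerivAt
      refine (h1.mul h2).congr_deriv ?_
      congr 2
      obtain ⟨e, he⟩ := Nat.exists_eq_add_of_lt (Nat.two_pow_pos (j + 1 - k))
      have he' : (2 : ℝ) ^ (j + 1 - k) = e + 1 := by exact_mod_cast (he.trans (by ring))
      rw [he', he]
      simp only [zero_add, Nat.add_sub_cancel, eval_mul, eval_add, eval_smul, smul_eq_mul, eval_pow, Pi.pow_apply]
      push_cast
      field_simp
      ring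
    set t : ℕ → ℝ := fun k => ((derivative (lhatNumerator α β j k) * α
      + (-(2 : ℝ) ^ (j + 1 - k)) • (lhatNumerator α β j k * derivative α))
        * α ^ (2 ^ (j + 1 - k) - 1)).eval x / α.eval x ^ (2 ^ (j + 1 - k) * 2)
        * iteratedDeriv k f x with ht
    have htop : t (j + 2) = 0 := by
      simp [ht, lhatNumerator_eq_zero α β (by omega : j + 1 < j + 2)]
    have hshift : ∑ k ∈ Finset.range (j + 2), t k
        = ∑ k ∈ Finset.range (j + 2), t (k + 1) + t 0 := by
      rw [← Finset.sum_range_succ', Finset.sum_range_succ t (j + 2), htop, add_zero]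
    rw [iteratedDeriv_succ, ih, (HasDerivAt.fun_sum fun k _ => hterm k).deriv,
      Finset.sum_add_distrib, hshift, Finset.sum_range_succ' _ (j + 2), add_right_comm,
      ← Finset.sum_add_distrib]
    congr 1
    · refine Finset.sum_congr rfl fun k hk => ?_
      rw [Finset.mem_range] at hk
      rw [lhatNumerator, eval_add, add_div, add_mul, add_comm, Nat.add_sub_add_right]
      congr 1
      rcases (by omega : k = j + 1 ∨ k ≤ j) with rfl | hk'
      · rw [htop]
        simp [lhatNumerator_eq_zero α β (by omega : j + 1 < j + 1 + 1)]
      · rw [show j + 1 - k = j + 1 - (k + 1) + 1 by omega, pow_succ]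

end operator

section weight

variable {φ : ℝ[X]} (heven : ∀ x : ℝ, φ.eval (-x) = φ.eval x)

include heven in
lemma eval_neg_derivative_of_even (x : ℝ) :
    (derivative φ).eval (-x) = -(derivative φ).eval x := by
  have h : φ.comp (-X) = φ := Polynomial.funext fun x => by simp [heven]
  have h' := congrArg (fun q => (derivative q).eval x) h
  simp only [derivative_comp, eval_comp, derivative_neg, derivative_X, eval_neg, eval_X,
    neg_one_mul] at h'
  linarith

include heven in
lemma exists_mul_derivative_lower_bound {m : ℕ} (hm : 1 ≤ m) (hdeg : φ.natDegree = 2 * m)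
    (hlead : 0 < φ.leadingCoeff) :
    ∃ K : ℝ, ∀ x : ℝ, φ.leadingCoeff * x ^ (2 * m) - K ≤ x * (derivative φ).eval x := by
  set q : ℝ[X] := X * derivative φ - φ.leadingCoeff • X ^ (2 * m) with hq
  have hm' : (1 : ℝ) ≤ m := by exact_mod_cast hm
  have hcoeff : q.coeff (2 * m) = φ.leadingCoeff * (2 * m - 1) := by
    obtain ⟨d, hd⟩ : ∃ d, 2 * m = d + 1 := ⟨2 * m - 1, by omega⟩
    have hd' : (d : ℝ) + 1 = 2 * m := by exact_mod_cast hd.symm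
    rw [hq, coeff_sub, hd, coeff_X_mul, coeff_derivative, coeff_smul, coeff_X_pow_self, ← hd, hd',
      leadingCoeff, hdeg, smul_eq_mul]
    ring
  have hcpos : 0 < q.coeff (2 * m) := by
    rw [hcoeff]
    exact mul_pos hlead (by linarith)
  have hqdeg : q.natDegree = 2 * m := by
    refine natDegree_eq_of_le_of_coeff_ne_zero ?_ hcpos.ne'
    refine (natDegree_sub_le _ _).trans (max_le (natDegree_mul_le.trans ?_)
      ((natDegree_smul_le φ.leadingCoeff (X ^ (2 * m) : ℝ[X])).trans (natDegree_X_pow_le _)))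
    have := natDegree_derivative_le φ
    rw [natDegree_X]
    omega
  obtain ⟨K, hK⟩ := exists_lower_bound_of_even q (by omega)
    (by rw [leadingCoeff, hqdeg]; exact hcpos.le) fun x => by
      simp [hq, eval_neg_derivative_of_even heven, (even_two_mul m).neg_pow]
  refine ⟨K, fun x => ?_⟩
  have h := hK x
  simp only [hq, eval_sub, eval_mul, eval_X, eval_smul, eval_pow, smul_eq_mul] at h
  linarith

variable (hint : ∀ q : ℝ[X], Integrable fun x : ℝ => q.eval x * Real.exp (-φ.eval x))

lemma weightFunctional_derivative (q : ℝ[X]) :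
    weightFunctional _ hint (derivative q) = weightFunctional _ hint (derivative φ * q) := by
  rw [← sub_eq_zero, ← map_sub]
  refine integral_eq_zero_of_hasDerivAt_of_integrable
    (f := fun x : ℝ => q.eval x * Real.exp (-φ.eval x)) (fun x => ?_) (hint _) (hint q)
  refine ((q.hasDerivAt x).mul (φ.hasDerivAt x).neg.exp).congr_deriv ?_
  simp only [eval_sub, eval_mul, Pi.neg_apply]
  ring

include heven in
lemma weightFunctional_comp_neg_X (q : ℝ[X]) :
    weightFunctional _ hint (q.comp (-X)) = weightFunctional _ hint q := by
  have h := integral_neg_eq_self (fun x : ℝ => q.eval x * Real.exp (-φ.eval x)) volume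
  simp only [heven] at h
  simpa [weightFunctional] using h

lemma weightFunctional_nonneg {ρ : ℝ → ℝ} (hρ : ∀ x, 0 ≤ ρ x)
    (hint : ∀ q : ℝ[X], Integrable fun x : ℝ => q.eval x * ρ x) (q : ℝ[X])
    (hq : ∀ x, 0 ≤ q.eval x) : 0 ≤ weightFunctional ρ hint q :=
  integral_nonneg fun x => mul_nonneg (hq x) (hρ x)

lemma integral_dividedDifference_mul {ρ : ℝ → ℝ}
    (hint : ∀ q : ℝ[X], Integrable fun x : ℝ => q.eval x * ρ x) {q : ℝ[X]} {D : ℝ → ℝ → ℝ}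
    (hD : ∀ x y, D x y * (x - y) = q.eval x - q.eval y) (W : ℝ[X]) (x : ℝ) :
    ∫ y, D x y * W.eval y * ρ y
      = (dividedDifferenceTransform (weightFunctional ρ hint) q W).eval x := by
  rw [eval_dividedDifferenceTransform]
  refine integral_congr_ae ?_
  filter_upwards [Measure.ae_ne volume x] with y hy
  rw [eval_mul, mul_right_cancel₀ (sub_ne_zero.2 hy.symm)
    ((hD x y).trans (eval_dividedDifference_mul q x y).symm)]

end weight

lemma isControlled_dividedDifferenceTransform {a : ℕ → ℝ} (ha : a 0 ≠ 0) (L : ℝ[X] →ₗ[ℝ] ℝ)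
    {q : ℝ[X]} {d r : ℕ} (hq : q.natDegree ≤ d + 1) (W : ℕ → ℝ[X]) {K : ℝ} (hK0 : 0 ≤ K)
    (hK : ∀ p, ∀ l ≤ d, |a (p + 1)| * |L (X ^ l * W (p + 1))| ≤ K * |a (p + 1)| ^ r) :
    IsControlled a r d fun p => a p • dividedDifferenceTransform L q (W p) := by
  refine isControlled_of_succ ha (fun p => (natDegree_smul_le _ _).trans
    ((natDegree_dividedDifferenceTransform_le _ _ _).trans (by omega)))
    ⟨(∑ k ∈ Finset.range (q.natDegree + 1), ∑ _i ∈ Finset.range k, |q.coeff k|) * K,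
      by positivity, fun p i => ?_⟩
  rcases eq_or_ne (a (p + 1)) 0 with h0 | h0
  · rw [h0, zero_smul, coeff_zero, abs_zero]
    positivity
  have ha' : 0 < |a (p + 1)| := abs_pos.2 h0
  rw [coeff_smul, smul_eq_mul, abs_mul]
  calc _ ≤ |a (p + 1)| * (_ * (K * |a (p + 1)| ^ r / |a (p + 1)|)) :=
        mul_le_mul_of_nonneg_left (abs_coeff_dividedDifferenceTransform_le L q _ (fun l hl => by
          rw [le_div_iff₀' ha']
          exact hK p l (hl.trans (by omega))) i) ha'.le
    _ = _ := by field_simp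

theorem stmt14 (m : ℕ) (hm : 1 ≤ m) (φ : Polynomial ℝ)
    (hφdeg : φ.natDegree = 2 * m) (hφlead : 0 < φ.leadingCoeff)
    (hφeven : ∀ x : ℝ, φ.eval (-x) = φ.eval x)
    (ρ : ℝ → ℝ) (hρ : ∀ x : ℝ, ρ x = Real.exp (-φ.eval x))
    (P : ℕ → Polynomial ℝ)
    (hPdeg : ∀ n, (P n).natDegree = n)
    (hPlead : ∀ n, 0 < (P n).leadingCoeff)
    (hPorth : ∀ i j, (∫ x : ℝ, (P i).eval x * (P j).eval x * ρ x)
        = if i = j then (1 : ℝ) else 0)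
    (a : ℕ → ℝ) (ha0 : a 0 = Real.sqrt (∫ x : ℝ, ρ x))
    (haS : ∀ n, 1 ≤ n → a n = ∫ x : ℝ, x * (P (n - 1)).eval x * (P n).eval x * ρ x)
    (D : ℝ → ℝ → ℝ)
    (hD : ∀ x y : ℝ, D x y * (x - y)
        = (Polynomial.derivative φ).eval x - (Polynomial.derivative φ).eval y)
    (A B : ℕ → ℝ → ℝ)
    (hA : ∀ n, ∀ x : ℝ, A n x = a n * ∫ y : ℝ, D x y * (P n).eval y ^ 2 * ρ y)
    (hB : ∀ n, ∀ x : ℝ,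
      B n x = a n * ∫ y : ℝ, D x y * (P n).eval y * (P (n - 1)).eval y * ρ y)
    (N₀ : ℕ) (hApos : ∀ p, N₀ ≤ p → ∀ x : ℝ, 0 < A p x) :
    ∃ Q Qt : ℕ → ℕ → ℕ → Polynomial ℝ,
      (∀ p, N₀ ≤ p → ∀ j : ℕ,
        (∀ f : ℝ → ℝ, ContDiff ℝ (⊤ : ℕ∞) f → ∀ x : ℝ,
          iteratedDeriv j (lhat (A p) (B p)
              (fun t => (Polynomial.derivative φ).eval t) f) x
            = ∑ k ∈ Finset.range (j + 2),
                (Q k j p).eval x / (A p x) ^ (2 ^ (j + 1 - k)) * iteratedDeriv k f x) ∧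
        Q (j + 1) j p = -1 ∧
        (∀ k ≤ j + 1, (Q k j p).natDegree ≤ 2 ^ (j + 1 - k) * (2 * m - 2) + 1) ∧
        (∀ k ≤ j + 1, Q k j p = (a p ^ (2 ^ (j + 1 - k) * (2 * m - 1) - 1)) • Qt k j p)) ∧
      (∀ k j : ℕ, ∃ M : ℝ, ∀ p, N₀ ≤ p → ∀ i : ℕ, |(Qt k j p).coeff i| ≤ M) := by
  obtain rfl : ρ = fun x => Real.exp (-φ.eval x) := funext hρ
  have hint := integrable_eval_mul_exp_neg φ (by omega) hφlead hφeven
  set L := weightFunctional _ hint with hLdef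
  have hL (i j : ℕ) : L (P i * P j) = if i = j then (1 : ℝ) else 0 := by
    rw [← hPorth]
    simp [hLdef, weightFunctional]
  have hpos := weightFunctional_nonneg (fun x => (Real.exp_pos (-φ.eval x)).le) hint
  have hψdeg : (derivative φ).natDegree ≤ 2 * m - 1 :=
    (natDegree_derivative_le φ).trans_eq (by rw [hφdeg])
  obtain ⟨K, hK⟩ := exists_mul_derivative_lower_bound hφeven hm hφdeg hφlead
  obtain ⟨κ, M, hκ, hM, hbounds⟩ := exists_moment_bounds hPdeg hPlead hL hpos
    (weightFunctional_derivative hint) hφlead hK hm hψdeg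
  have haL (n : ℕ) : a (n + 1) = L (X * P n * P (n + 1)) := by
    rw [haS (n + 1) (by omega)]
    simp [hLdef, weightFunctional]
  simp only [← haL] at hbounds
  have ha0pos : 0 < a 0 := by
    rw [ha0]
    exact Real.sqrt_pos.2 (integral_exp_pos (by simpa using hint 1))
  set κ₀ : ℝ := min 1 (min κ |a 0|) with hκ₀
  have hκ₀pos : 0 < κ₀ := lt_min one_pos (lt_min hκ (abs_pos.2 ha0pos.ne'))
  have ha (p : ℕ) : κ₀ ≤ |a p| := by
    refine (min_le_right _ _).trans ?_
    rcases p with _ | p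
    · exact min_le_right _ _
    · exact (min_le_left _ _).trans (hbounds p).1
  have hapos (p : ℕ) : 0 < |a p| := hκ₀pos.trans_le (ha p)
  obtain ⟨d, hd⟩ : ∃ d, 2 * m = d + 2 := ⟨2 * m - 2, by omega⟩
  have hd_even : Even d := ⟨m - 1, by omega⟩
  have hpow {r r' : ℕ} (h : r ≤ r') (p : ℕ) : |a p| ^ r ≤ 1 / κ₀ ^ r' * |a p| ^ r' := by
    rw [one_div, ← div_eq_inv_mul, le_div_iff₀ (by positivity)]
    calc |a p| ^ r * κ₀ ^ r' ≤ |a p| ^ r * κ₀ ^ (r' - r) :=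
          mul_le_mul_of_nonneg_left
            (pow_le_pow_of_le_one hκ₀pos.le (min_le_left _ _) (Nat.sub_le _ _)) (by positivity)
      _ ≤ |a p| ^ r * |a p| ^ (r' - r) := by gcongr; exact ha p
      _ = |a p| ^ r' := by rw [← pow_add, Nat.add_sub_cancel' h]
  set α : ℕ → ℝ[X] := fun p => a p • dividedDifferenceTransform L (derivative φ) (P p ^ 2) with hα
  set β : ℕ → ℝ[X] := fun p =>
    a p • dividedDifferenceTransform L (derivative φ) (P p * P (p - 1)) + derivative φ with hβ
  have hAα (p : ℕ) (x : ℝ) : A p x = (α p).eval x := by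
    rw [hA, hα, eval_smul, smul_eq_mul, ← integral_dividedDifference_mul hint hD]
    simp only [eval_pow]
  have hBβ (p : ℕ) (x : ℝ) : B p x + (derivative φ).eval x = (β p).eval x := by
    rw [hB, hβ, eval_add, eval_smul, smul_eq_mul, ← integral_dividedDifference_mul hint hD]
    simp only [eval_mul, mul_assoc]
  have hscale {l r : ℕ} (hl : l + 1 ≤ r) (p : ℕ) {t : ℝ} (ht : t ≤ M * |a (p + 1)| ^ l) :
      |a (p + 1)| * t ≤ M * (1 / κ₀ ^ r) * |a (p + 1)| ^ r :=
    calc |a (p + 1)| * t ≤ |a (p + 1)| * (M * |a (p + 1)| ^ l) := by gcongr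
      _ = M * |a (p + 1)| ^ (l + 1) := by ring
      _ ≤ M * (1 / κ₀ ^ r * |a (p + 1)| ^ r) := by gcongr; exact hpow hl _
      _ = _ := by ring
  have hαc : IsControlled a (d + 1) d α :=
    isControlled_dividedDifferenceTransform ha0pos.ne' L (by omega) _ (by positivity)
      fun p l hl => hscale (by omega) p ((hbounds p).2 l (by omega)).1
  have hβc : IsControlled a d (d + 1) β := by
    refine .add (IsControlled.mono ?_ hκ₀pos ha le_rfl (Nat.le_succ d))
      ((isControlled_const (derivative φ) (by omega)).mono hκ₀pos ha (Nat.zero_le _) le_rfl)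
    refine isControlled_dividedDifferenceTransform ha0pos.ne' L (by omega)
      (fun p => P p * P (p - 1)) (K := M * (1 / κ₀ ^ d)) (by positivity) fun p l hl => ?_
    rw [Nat.add_sub_cancel]
    rcases hl.eq_or_lt with rfl | hl
    · rw [functional_even_pow_mul_eq_zero hPdeg hPlead hL (weightFunctional_comp_neg_X hφeven hint)
        p hd_even, abs_zero, mul_zero]
      positivity
    · exact hscale (by omega) p ((hbounds p).2 l (by omega)).2
  have hQ {j k : ℕ} (hk : k ≤ j + 1) := isControlled_lhatNumerator hκ₀pos ha hαc hβc hk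
  rw [show 2 * m - 2 = d by omega, show 2 * m - 1 = d + 1 by omega]
  refine ⟨fun k j p => lhatNumerator (α p) (β p) j k, fun k j p => if k ≤ j + 1 then
    (a p ^ (2 ^ (j + 1 - k) * (d + 1) - 1))⁻¹ • lhatNumerator (α p) (β p) j k else 0,
    fun p hp j => ⟨fun f hf x => ?_, lhatNumerator_top _ _ _, fun k hk => (hQ hk).1 p,
      fun k hk => ?_⟩, fun k j => ?_⟩
  · rw [iteratedDeriv_lhat (hAα p) (hBβ p)
      (fun x => by rw [← hAα]; exact (hApos p hp x).ne') hf]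
    simp only [hAα]
  · beta_reduce
    rw [if_pos hk, smul_inv_smul₀ (pow_ne_zero _ (abs_pos.1 (hapos p)))]
  · by_cases hk : k ≤ j + 1
    · obtain ⟨-, C, -, hC⟩ := hQ hk
      refine ⟨C, fun p _ i => ?_⟩
      beta_reduce
      rw [if_pos hk, coeff_smul, smul_eq_mul, abs_mul, abs_inv, abs_pow,
        inv_mul_le_iff₀ (pow_pos (hapos p) _), mul_comm]
      exact hC p i
    · exact ⟨0, fun p _ i => by simp [hk]⟩
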